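/- Let (V,g,J) be a pseudo-hermitian vector space and let A, B be hermitian endomorphisms of V. Then the scalar curvature of R_{A,B} satisfies Scal(R_{A,B}) = 2·(tr(A)·tr(B) + 2·tr(A∘B)). -/

import Mathlib

open Finset Polynomial

noncomputable section

/-- Kulkarni–Nomizu product of two bilinear forms (as 4-tensor):
`(P⊘Q)(x,y,u,v) = P(x,u)Q(y,v) − P(x,v)Q(y,u) + Q(x,u)P(y,v) − Q(x,v)P(y,u)`. -/
def KN4 {V : Type*} [AddCommGroup V] [Module ℝ V] (P Q : V → V → ℝ) (x y u v : V) : ℝ :=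
  P x u * Q y v - P x v * Q y u + Q x u * P y v - Q x v * P y u

/-- Symmetric product `(P⊙Q)(x,y,u,v) = P(x,y)Q(u,v) + Q(x,y)P(u,v)`. -/
def SP4 {V : Type*} [AddCommGroup V] [Module ℝ V] (P Q : V → V → ℝ) (x y u v : V) : ℝ :=
  P x y * Q u v + Q x y * P u v

/-- `R_{A,B} = gA⊘gB + ωA⊘ωB + 2·ωA⊙ωB`, where `gA = g(A·,·)` and `ωA = ω(A·,·)`
with `ω(x,y) = g(Jx,y)`. -/
def RAB {V : Type*} [AddCommGroup V] [Module ℝ V]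
    (g : V →ₗ[ℝ] V →ₗ[ℝ] ℝ) (J A B : Module.End ℝ V) (x y u v : V) : ℝ :=
  KN4 (fun a b => g (A a) b) (fun a b => g (B a) b) x y u v
    + KN4 (fun a b => g (J (A a)) b) (fun a b => g (J (B a)) b) x y u v
    + 2 * SP4 (fun a b => g (J (A a)) b) (fun a b => g (J (B a)) b) x y u v

/-- An endomorphism that is skew with respect to a nondegenerate bilinear form is traceless. -/
theorem trace_eq_zero_of_skew {V : Type*} [AddCommGroup V] [Module ℝ V] [FiniteDimensional ℝ V]
    (g : V →ₗ[ℝ] V →ₗ[ℝ] ℝ) (hgnd : ∀ x : V, (∀ y : V, g x y = 0) → x = 0)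
    (T : Module.End ℝ V) (hT : ∀ x y : V, g (T x) y = -g x (T y)) :
    LinearMap.trace ℝ V T = 0 := by
  have hinj : Function.Injective g := by
    rw [injective_iff_map_eq_zero]
    intro x hx
    exact hgnd x fun y => by rw [hx]; rfl
  let e : V ≃ₗ[ℝ] Module.Dual ℝ V :=
    LinearEquiv.ofInjectiveOfFinrankEq g hinj Subspace.dual_finrank_eq.symm
  have he : ∀ x, e x = g x := fun x => rfl
  have hconj : e.conj T = (-1 : ℝ) • Module.Dual.transpose (R := ℝ) T := by
    ext f y
    obtain ⟨x, rfl⟩ := e.surjective f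
    rw [LinearEquiv.conj_apply_apply, LinearEquiv.symm_apply_apply]
    simpa using! hT x y
  have h := LinearMap.trace_conj' T e
  rw [hconj, map_smul, LinearMap.trace_transpose', smul_eq_mul] at h
  linarith

/-- The endomorphism `z ↦ R(z, x) y` of the curvature tensor `R_{A,B}`. -/
def ricciEndRAB {V : Type*} [AddCommGroup V] [Module ℝ V]
    (g : V →ₗ[ℝ] V →ₗ[ℝ] ℝ) (J A B : Module.End ℝ V) (x y : V) : Module.End ℝ V :=
  g (B y) x • A - (g (B y)).smulRight (A x) + g (A y) x • B - (g (A y)).smulRight (B x)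
    - g (J (B y)) x • (A * J) + (g (J (B y))).smulRight (A (J x))
    - g (J (A y)) x • (B * J) + (g (J (A y))).smulRight (B (J x))
    - (2 : ℝ) • ((g.flip x).comp (J * B)).smulRight (A (J y))
    - (2 : ℝ) • ((g.flip x).comp (J * A)).smulRight (B (J y))

/-- `Scal(R_{A,B}) = 2·(tr(A)·tr(B) + 2·tr(A∘B))`. -/
theorem stmt7
    (V : Type*) [AddCommGroup V] [Module ℝ V] [FiniteDimensional ℝ V]
    (g : V →ₗ[ℝ] V →ₗ[ℝ] ℝ)
    (hgsymm : ∀ x y : V, g x y = g y x)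
    (hgnd : ∀ x : V, (∀ y : V, g x y = 0) → x = 0)
    (J : Module.End ℝ V)
    (hJ2 : J * J = -1)
    (hJg : ∀ x y : V, g (J x) (J y) = g x y)
    (A : Module.End ℝ V)
    (hAg : ∀ x y : V, g (A x) y = g x (A y))
    (hAJ : A * J = J * A)
    (B : Module.End ℝ V)
    (hBg : ∀ x y : V, g (B x) y = g x (B y))
    (hBJ : B * J = J * B)
    (Rend : V → V → V → V)
    (hRend : ∀ x y u v : V, g x (Rend u v y) = RAB g J A B x y u v)
    (Ric : V → V → ℝ)
    (hRic : ∀ (x y : V) (L : V →ₗ[ℝ] V), (∀ z : V, L z = Rend z x y) →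
      Ric x y = LinearMap.trace ℝ V L)
    (ric : Module.End ℝ V)
    (hric : ∀ x y : V, g x (ric y) = Ric x y) :
    LinearMap.trace ℝ V ric =
      2 * (LinearMap.trace ℝ V A * LinearMap.trace ℝ V B
        + 2 * LinearMap.trace ℝ V (A * B)) := by
  have hJJ : ∀ x, J (J x) = -x := fun x => by simpa using LinearMap.congr_fun hJ2 x
  have hAJ' : ∀ x, A (J x) = J (A x) := fun x => LinearMap.congr_fun hAJ x
  have hBJ' : ∀ x, B (J x) = J (B x) := fun x => LinearMap.congr_fun hBJ x
  have hJskew : ∀ x y, g (J x) y = -g x (J y) := fun x y => by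
    rw [← hJg x (J y), hJJ, map_neg, neg_neg]
  have hext : ∀ a b : V, (∀ w, g w a = g w b) → a = b := fun a b h => by
    refine sub_eq_zero.mp (hgnd _ fun w => ?_)
    rw [hgsymm, map_sub, h, sub_self]
  have htrAJ : LinearMap.trace ℝ V (A * J) = 0 :=
    trace_eq_zero_of_skew g hgnd _ fun x y => by
      simp only [Module.End.mul_apply]
      rw [hAg, hJskew, hAJ']
  have htrBJ : LinearMap.trace ℝ V (B * J) = 0 :=
    trace_eq_zero_of_skew g hgnd _ fun x y => by
      simp only [Module.End.mul_apply]
      rw [hBg, hJskew, hBJ']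
  have hL : ∀ x y z, ricciEndRAB g J A B x y z = Rend z x y := fun x y z => by
    refine hext _ _ fun w => ?_
    rw [hRend]
    simp only [ricciEndRAB, RAB, KN4, SP4, LinearMap.add_apply, LinearMap.sub_apply,
      LinearMap.smul_apply, LinearMap.smulRight_apply, LinearMap.comp_apply,
      LinearMap.flip_apply, Module.End.mul_apply, map_add, map_sub, map_smul, smul_eq_mul,
      hJskew (A w), hJskew (B w), hAg w, hBg w]
    ring
  have hric_eq : ric = LinearMap.trace ℝ V A • B + LinearMap.trace ℝ V B • A
      + (2 : ℝ) • (A * B) + (2 : ℝ) • (B * A) := by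
    ext y
    refine hext _ _ fun x => ?_
    rw [hric, hRic x y _ (hL x y), hgsymm]
    simp only [ricciEndRAB, map_add, map_sub, map_smul, LinearMap.trace_smulRight, htrAJ, htrBJ,
      LinearMap.add_apply, LinearMap.smul_apply, LinearMap.comp_apply, LinearMap.flip_apply,
      Module.End.mul_apply, smul_eq_mul, hAJ', hBJ', hJg, hJJ, map_neg,
      ← hAg (B y), ← hBg (A y)]
    ring
  rw [hric_eq]
  simp only [map_add, map_smul, smul_eq_mul, LinearMap.trace_mul_comm ℝ B A]
  ring
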